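/- arXiv:2408.11784 — 4 statements merged into one kernel-verified Lean document; each statement's English description precedes it below -/
import Mathlib

section
/- Let U = {x ∈ M | 1 + φ(x) is a unit of R}. Then U is a group under the operation x · y = x + (1 + φ(x)) • y: the operation is well defined on U (if 1 + φ(x) and 1 + φ(y) are units of R then so is 1 + φ(x · y), since 1 + φ(x · y) = (1 + φ(x))(1 + φ(y))), it is associative, the element 0 ∈ U is a two-sided identity, and the two-sided inverse of x ∈ U is −(1 + φ(x))⁻¹ • x. -/
/-- The affine functional `1 + φ` turns `x + (1 + φ x) • y` into a product. -/
theorem LinearMap.one_add_apply_add_smul {R M : Type*} [CommRing R] [AddCommGroup M] [Module R M]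
    (φ : M →ₗ[R] R) (x y : M) :
    1 + φ (x + (1 + φ x) • y) = (1 + φ x) * (1 + φ y) := by
  simp only [map_add, map_smul, smul_eq_mul]
  ring

/-- The affine functional `1 + φ` sends `-(1 + φ x)⁻¹ • x` to `(1 + φ x)⁻¹`. -/
theorem LinearMap.one_add_apply_neg_inverse_smul {R M : Type*} [CommRing R] [AddCommGroup M]
    [Module R M] (φ : M →ₗ[R] R) {x : M} (hx : IsUnit (1 + φ x)) :
    1 + φ (-(Ring.inverse (1 + φ x)) • x) = Ring.inverse (1 + φ x) := by
  simp only [map_smul, smul_eq_mul]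
  linear_combination -Ring.inverse_mul_cancel _ hx

/-- Let `R` be a commutative ring, `M` an `R`-module, and `φ : M → R` an `R`-linear map.
Let `U = {x ∈ M | 1 + φ(x) is a unit of R}`.  Then `U` is a group under the operation
`x · y = x + (1 + φ(x)) • y`: the operation is well defined on `U` (indeed
`1 + φ(x · y) = (1 + φ(x))(1 + φ(y))`), it is associative, `0 ∈ U` is a two-sided
identity, and the two-sided inverse of `x ∈ U` is `−(1 + φ(x))⁻¹ • x`. -/
theorem crowell_group_structure {R M : Type*} [CommRing R] [AddCommGroup M] [Module R M]
    (φ : M →ₗ[R] R) :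
    let U : Set M := {x | IsUnit (1 + φ x)}
    -- well-definedness: `U` is closed under the operation, since
    -- `1 + φ(x · y) = (1 + φ(x))(1 + φ(y))`
    (∀ x ∈ U, ∀ y ∈ U,
      (1 + φ (x + (1 + φ x) • y) = (1 + φ x) * (1 + φ y)) ∧
      x + (1 + φ x) • y ∈ U) ∧
    -- associativity
    (∀ x ∈ U, ∀ y ∈ U, ∀ z ∈ U,
      (x + (1 + φ x) • y) + (1 + φ (x + (1 + φ x) • y)) • z
        = x + (1 + φ x) • (y + (1 + φ y) • z)) ∧
    -- `0` is a two-sided identity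
    ((0 : M) ∈ U ∧
      ∀ x ∈ U, ((0 : M) + (1 + φ (0 : M)) • x = x ∧ x + (1 + φ x) • (0 : M) = x)) ∧
    -- `−(1 + φ(x))⁻¹ • x` is a two-sided inverse of `x`
    (∀ x ∈ U,
      (-(Ring.inverse (1 + φ x)) • x ∈ U ∧
       x + (1 + φ x) • (-(Ring.inverse (1 + φ x)) • x) = 0 ∧
       (-(Ring.inverse (1 + φ x)) • x)
         + (1 + φ (-(Ring.inverse (1 + φ x)) • x)) • x = 0)) := by
  intro U
  refine ⟨fun x hx y hy => ⟨φ.one_add_apply_add_smul x y, ?_⟩, fun x _ y _ z _ => ?_,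
    ⟨?_, fun x _ => ⟨by simp, by simp⟩⟩, fun x hx => ⟨?_, ?_, ?_⟩⟩
  · change IsUnit _
    rw [φ.one_add_apply_add_smul]
    exact IsUnit.mul hx hy
  · rw [φ.one_add_apply_add_smul, smul_add, smul_smul, add_assoc]
  · simp [U]
  · change IsUnit _
    rw [φ.one_add_apply_neg_inverse_smul hx]
    exact IsUnit.ringInverse hx
  · rw [smul_smul, mul_neg, Ring.mul_inverse_cancel _ hx, neg_one_smul, add_neg_cancel]
  · rw [φ.one_add_apply_neg_inverse_smul hx, neg_smul, neg_add_cancel]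
end

section
/- Let U = {x ∈ M | 1 + φ(x) is a unit of R}, regarded as a group under the operation x · y = x + (1 + φ(x)) • y, with inverse x⁻¹ = −(1 + φ(x))⁻¹ • x. Then for all x, y ∈ U, conjugation in this group is given by the formula y · x · y⁻¹ = (1 + φ(y)) • x − φ(x) • y. -/
/-- Let `R` be a commutative ring, `M` an `R`-module, and `φ : M → R` an `R`-linear map.
Let `U = {x ∈ M | 1 + φ(x) is a unit of R}`, a group under `x · y = x + (1 + φ(x)) • y`
with inverse `x⁻¹ = −(1 + φ(x))⁻¹ • x`.  Then for all `x, y ∈ U`, conjugation in this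
group is given by `y · x · y⁻¹ = (1 + φ(y)) • x − φ(x) • y`. -/
theorem crowell_group_conjugation {R M : Type*} [CommRing R] [AddCommGroup M] [Module R M]
    (φ : M →ₗ[R] R) :
    let U : Set M := {x | IsUnit (1 + φ x)}
    ∀ x ∈ U, ∀ y ∈ U,
      y + (1 + φ y) • (x + (1 + φ x) • (-(Ring.inverse (1 + φ y)) • y))
        = (1 + φ y) • x - φ x • y := by
  intro U x _ y hy
  have h : (1 + φ y) * Ring.inverse (1 + φ y) = 1 := Ring.mul_inverse_cancel _ hy
  have hc : (1 + φ y) * (1 + φ x) * -Ring.inverse (1 + φ y) = -(1 + φ x) := by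
    linear_combination -(1 + φ x) * h
  rw [smul_add, smul_smul, smul_smul, hc]
  module
end

section
/- Let U = {x ∈ M | 1 + φ(x) is a unit of R}. Define x ▷ y = (1 + φ(y)) • x − φ(x) • y for x, y ∈ U. Then: (a) U is closed under ▷ (indeed φ(x ▷ y) = φ(x)); (b) x ▷ x = x for all x ∈ U; (c) for each fixed y ∈ U, the map x ↦ x ▷ y is a bijection of U onto itself; (d) (x ▷ y) ▷ z = (x ▷ z) ▷ (y ▷ z) for all x, y, z ∈ U. In other words, (U, ▷) is a quandle. -/
/-- `φ` is invariant under the Crowell operation. -/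
theorem map_crowell_op {R M : Type*} [CommRing R] [AddCommGroup M] [Module R M]
    (φ : M →ₗ[R] R) (x y : M) : φ ((1 + φ y) • x - φ x • y) = φ x := by
  simp only [map_sub, map_smul, smul_eq_mul]
  ring

/-- Let `R` be a commutative ring, `M` an `R`-module, and `φ : M → R` an `R`-linear map.
Let `U = {x ∈ M | 1 + φ(x) is a unit of R}`, and define `x ▷ y = (1 + φ(y)) • x − φ(x) • y`.
Then: (a) `U` is closed under `▷` (indeed `φ(x ▷ y) = φ(x)`); (b) `x ▷ x = x` for all
`x ∈ U`; (c) for each fixed `y ∈ U`, the map `x ↦ x ▷ y` is a bijection of `U` onto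
itself; (d) `(x ▷ y) ▷ z = (x ▷ z) ▷ (y ▷ z)`.  In other words, `(U, ▷)` is a quandle. -/
theorem crowell_quandle_structure {R M : Type*} [CommRing R] [AddCommGroup M] [Module R M]
    (φ : M →ₗ[R] R) :
    let U : Set M := {x | IsUnit (1 + φ x)}
    let op : M → M → M := fun x y => (1 + φ y) • x - φ x • y
    -- (a) closure, via `φ(x ▷ y) = φ(x)`
    (∀ x ∈ U, ∀ y ∈ U, φ (op x y) = φ x ∧ op x y ∈ U) ∧
    -- (b) idempotence
    (∀ x ∈ U, op x x = x) ∧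
    -- (c) right translations are bijections of `U`
    (∀ y ∈ U, Set.BijOn (fun x => op x y) U U) ∧
    -- (d) right self-distributivity
    (∀ x ∈ U, ∀ y ∈ U, ∀ z ∈ U, op (op x y) z = op (op x z) (op y z)) := by
  intro U op
  have hφ (x y : M) : φ (op x y) = φ x := map_crowell_op φ x y
  have hU {x : M} (hx : x ∈ U) (y : M) : op x y ∈ U := by
    change IsUnit (1 + φ (op x y))
    rwa [hφ]
  refine ⟨fun x hx y _ => ⟨hφ x y, hU hx y⟩, fun x _ => ?_, fun y hy => ⟨?_, ?_, ?_⟩,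
    fun x _ y _ z _ => ?_⟩
  · simp only [op]
    module
  · exact fun x hx => hU hx y
  · intro a _ b _ hab
    have hab' : op a y = op b y := hab
    have h : φ a = φ b := by rw [← hφ a y, hab', hφ]
    simp only [op, h, sub_left_inj] at hab'
    exact hy.smul_left_cancel.mp hab'
  · intro w hw
    obtain ⟨v, hv⟩ := hy.exists_right_inv
    have hφv : φ (v • (w + φ w • y)) = φ w := by
      simp only [map_smul, map_add, smul_eq_mul]
      linear_combination φ w * hv
    refine ⟨v • (w + φ w • y), ?_, ?_⟩
    · change IsUnit (1 + φ (v • (w + φ w • y)))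
      rwa [hφv]
    · simp only [op, hφv, smul_smul, hv, one_smul, add_sub_cancel_right]
  · change (1 + φ z) • op x y - φ (op x y) • z =
      (1 + φ (op y z)) • op x z - φ (op x z) • op y z
    simp only [hφ]
    simp only [op]
    module
end

section
/- With the data below, the formula (i, x + X_i) ▷ (j, y + X_j) = (i, (m_j − m_i) + t·x + (1 − t)·y + X_i) gives a well-defined binary operation ▷ on the disjoint union Q = ⨆_{i ∈ I} N/X_i (well-defined because m_j − m_i ∈ N and because (1 − t)·X_j = 0 ⊆ X_i), and (Q, ▷) is a quandle: (a) q ▷ q = q for every q ∈ Q; (b) for each fixed q ∈ Q, the map p ↦ p ▷ q is a bijection of Q onto itself; (c) (p ▷ q) ▷ r = (p ▷ r) ▷ (q ▷ r) for all p, q, r ∈ Q. -/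
open LaurentPolynomial

/-- Multiplication by `1 - t` on `N`, descended to a quotient by a submodule it annihilates. -/
noncomputable def oneSubT {N : Type} [AddCommGroup N] [Module (LaurentPolynomial ℤ) N]
    (X : Submodule (LaurentPolynomial ℤ) N)
    (hX : ∀ x ∈ X, ((1 : LaurentPolynomial ℤ) - T 1) • x = (0 : N)) :
    (N ⧸ X) →ₗ[LaurentPolynomial ℤ] N :=
  X.liftQ (LinearMap.lsmul (LaurentPolynomial ℤ) N (1 - T 1)) hX

theorem bijective_add_T_smul_add {A : Type} [AddCommGroup A] [Module (LaurentPolynomial ℤ) A]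
    (a b : A) :
    Function.Bijective fun x : A => a + (T 1 : LaurentPolynomial ℤ) • x + b := by
  have hT : IsUnit (T 1 : LaurentPolynomial ℤ) := isUnit_T 1
  exact (AddGroup.addRight_bijective b).comp
    ((AddGroup.addLeft_bijective a).comp hT.smul_bijective)

/-- Let `Λ = ℤ[t^{±1}]`, let `M` be a `Λ`-module with submodule `N`, let `I` be a nonempty
index set, let `m_i ∈ M` with `m_i − m_j ∈ N` for all `i, j`, and for each `i` let `X_i` be
a submodule of `N` with `(1 − t) • X_i = 0`.  Then the formula
`(i, x + X_i) ▷ (j, y + X_j) = (i, (m_j − m_i) + t•x + (1 − t)•y + X_i)` gives a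
well-defined binary operation `▷` on the disjoint union `Q = ⨆_{i ∈ I} N/X_i`, and
`(Q, ▷)` is a quandle: (a) `q ▷ q = q`; (b) each right translation `p ↦ p ▷ q` is a
bijection of `Q`; (c) `(p ▷ q) ▷ r = (p ▷ r) ▷ (q ▷ r)`. -/
theorem medial_quandle_construction (I : Type) [Nonempty I]
    (M : Type) [AddCommGroup M] [Module (LaurentPolynomial ℤ) M]
    (N : Submodule (LaurentPolynomial ℤ) M)
    (m : I → M) (hm : ∀ i j : I, m i - m j ∈ N)
    (X : I → Submodule (LaurentPolynomial ℤ) ↥N)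
    (hX : ∀ i : I, ∀ x ∈ X i, ((1 : LaurentPolynomial ℤ) - T 1) • x = (0 : ↥N)) :
    ∃ op : ((i : I) × (↥N ⧸ X i)) → ((i : I) × (↥N ⧸ X i)) → ((i : I) × (↥N ⧸ X i)),
      -- the operation is given by the stated formula on representatives
      (∀ (i j : I) (x y : ↥N),
        op ⟨i, Submodule.Quotient.mk x⟩ ⟨j, Submodule.Quotient.mk y⟩
          = ⟨i, Submodule.Quotient.mk
              (⟨(m j - m i) + T 1 • (x : M) + ((1 : LaurentPolynomial ℤ) - T 1) • (y : M),
                N.add_mem (N.add_mem (hm j i) (N.smul_mem _ x.2)) (N.smul_mem _ y.2)⟩ : ↥N)⟩) ∧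
      -- well-definedness: the formula determines `op` uniquely
      (∀ op' : ((i : I) × (↥N ⧸ X i)) → ((i : I) × (↥N ⧸ X i)) → ((i : I) × (↥N ⧸ X i)),
        (∀ (i j : I) (x y : ↥N),
          op' ⟨i, Submodule.Quotient.mk x⟩ ⟨j, Submodule.Quotient.mk y⟩
            = ⟨i, Submodule.Quotient.mk
                (⟨(m j - m i) + T 1 • (x : M) + ((1 : LaurentPolynomial ℤ) - T 1) • (y : M),
                  N.add_mem (N.add_mem (hm j i) (N.smul_mem _ x.2)) (N.smul_mem _ y.2)⟩ : ↥N)⟩)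
          → op' = op) ∧
      -- (a) idempotence
      (∀ q, op q q = q) ∧
      -- (b) right translations are bijections
      (∀ q, Function.Bijective (fun p => op p q)) ∧
      -- (c) right self-distributivity
      (∀ p q r, op (op p q) r = op (op p r) (op q r)) := by
  have mk_eq : ∀ {i : I} {x y : ↥N}, (x : M) = y →
      (⟨i, Submodule.Quotient.mk x⟩ : (i : I) × (↥N ⧸ X i)) = ⟨i, Submodule.Quotient.mk y⟩ :=
    fun h => by rw [Subtype.ext h]
  let f : ((j : I) × (↥N ⧸ X j)) → ∀ i : I, ↥N ⧸ X i → ↥N ⧸ X i := fun q i x =>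
    Submodule.Quotient.mk ⟨m q.1 - m i, hm q.1 i⟩ + (T 1 : LaurentPolynomial ℤ) • x
      + Submodule.Quotient.mk (oneSubT (X q.1) (hX q.1) q.2)
  let op : ((i : I) × (↥N ⧸ X i)) → ((i : I) × (↥N ⧸ X i)) → ((i : I) × (↥N ⧸ X i)) :=
    fun p q => ⟨p.1, f q p.1 p.2⟩
  have hop : ∀ (i j : I) (x y : ↥N),
      op ⟨i, Submodule.Quotient.mk x⟩ ⟨j, Submodule.Quotient.mk y⟩
        = ⟨i, Submodule.Quotient.mk
            (⟨(m j - m i) + T 1 • (x : M) + ((1 : LaurentPolynomial ℤ) - T 1) • (y : M),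
              N.add_mem (N.add_mem (hm j i) (N.smul_mem _ x.2)) (N.smul_mem _ y.2)⟩ : ↥N)⟩ :=
    fun _ _ _ _ => rfl
  refine ⟨op, hop, ?_, ?_, ?_, ?_⟩
  · intro op' hop'
    funext ⟨i, x⟩ ⟨j, y⟩
    obtain ⟨x, rfl⟩ := Submodule.Quotient.mk_surjective _ x
    obtain ⟨y, rfl⟩ := Submodule.Quotient.mk_surjective _ y
    rw [hop', hop]
  · rintro ⟨i, x⟩
    obtain ⟨x, rfl⟩ := Submodule.Quotient.mk_surjective _ x
    rw [hop]
    apply mk_eq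
    module
  · intro q
    have h : ∀ i, Function.Bijective (f q i) := fun i => bijective_add_T_smul_add _ _
    exact (Equiv.sigmaCongrRight fun i => Equiv.ofBijective (f q i) (h i)).bijective
  · rintro ⟨i, x⟩ ⟨j, y⟩ ⟨k, z⟩
    obtain ⟨x, rfl⟩ := Submodule.Quotient.mk_surjective _ x
    obtain ⟨y, rfl⟩ := Submodule.Quotient.mk_surjective _ y
    obtain ⟨z, rfl⟩ := Submodule.Quotient.mk_surjective _ z
    simp only [hop]
    apply mk_eq
    module
end
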